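/- arXiv:2105.00955 — 2 statements merged into one kernel-verified Lean document; each statement's English description precedes it below -/
import Mathlib

section
/- Let A be a unital alternative *-algebra over ℂ containing a nontrivial symmetric idempotent e satisfying conditions (♠) and (♣), let Φ : A → A be a map satisfying the *-Jordan n-derivation identity in the last two slots, and let φ = Φ − Ξ_{y,e₁} where y = e₁(Φ(e₁)e₂) + e₂(Φ(e₁)e₁). Then: (1) φ(a • b) = φ(a) • b + a • φ(b) for all a, b ∈ A; (2) φ(e₁) = 0 and φ(e₂) = 0; (3) φ is additive; (4) φ(a*) = φ(a)* for all a ∈ A. -/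
/-- The Jordan `•`-product `a • b = ab + b a*`. -/
def starJordan {A : Type*} [NonAssocRing A] [StarRing A] (a b : A) : A :=
  a * b + b * star a

/-- Left-normed iterated Jordan `•`-product of a list (empty list ↦ 0, junk value). -/
def leftStarJordan {A : Type*} [NonAssocRing A] [StarRing A] : List A → A
  | [] => 0
  | x :: xs => xs.foldl starJordan x

/-- The family `a₁ = ⋯ = a_{n-2} = 1`, `a_{n-1} = x`, `a_n = y`. -/
def lastTwoFamily {A : Type*} [One A] (n : ℕ) (x y : A) : Fin n → A :=
  fun i => if (i : ℕ) = n - 2 then x else if (i : ℕ) = n - 1 then y else 1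

/-- `e₁ = e`, `e₂ = 1 - e`. -/
def peirceIdem {A : Type*} [NonAssocRing A] (e : A) : Fin 2 → A :=
  fun i => if i = 0 then e else 1 - e

/-- Membership in the Peirce component `A_{ij}`: `eᵢ x = x` and `x eⱼ = x`. -/
def inPeirce {A : Type*} [NonAssocRing A] (e : A) (i j : Fin 2) (x : A) : Prop :=
  peirceIdem e i * x = x ∧ x * peirceIdem e j = x

/-- The inner derivation `Ξ_{y,z}(a) = y(za) − z(ya) + y(az) − (ya)z + (az)y − (ay)z`. -/
def innerDer {A : Type*} [NonAssocRing A] (y z a : A) : A :=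
  y * (z * a) - z * (y * a) + y * (a * z) - (y * a) * z + (a * z) * y - (a * y) * z

/-- `x` is a joint eigenvector of left and right multiplication by `e`, with integer eigenvalues
`i` and `j`. For an idempotent `e` the values `0, 1` give the Peirce components. -/
def Peirce {A : Type*} [NonAssocRing A] (e : A) (i j : ℤ) (x : A) : Prop :=
  e * x = i • x ∧ x * e = j • x

section Alternative

variable {A : Type*} [NonAssocRing A]

theorem associator_swap_left (halt₁ : ∀ a b : A, a * a * b = a * (a * b)) (x y z : A) :
    associator y x z = -associator x y z := by
  have h := halt₁ (x + y) z
  simp only [add_mul, mul_add, halt₁, associator_apply] at h ⊢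
  grind

theorem associator_swap_right (halt₂ : ∀ a b : A, b * a * a = b * (a * a)) (x y z : A) :
    associator x z y = -associator x y z := by
  have h := halt₂ (y + z) x
  simp only [add_mul, mul_add, halt₂, associator_apply] at h ⊢
  grind

theorem innerDer_eq_associator (halt₁ : ∀ a b : A, a * a * b = a * (a * b))
    (halt₂ : ∀ a b : A, b * a * a = b * (a * a)) (y z a : A) :
    innerDer y z a = y * z * a - z * y * a - a * (y * z) + a * (z * y) - 3 • associator y z a := by
  have h1 := associator_swap_left halt₁ y z a
  have h2 := associator_swap_right halt₂ y z a
  have h3 := associator_swap_left halt₁ y a z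
  have h4 := associator_swap_right halt₂ a y z
  simp only [innerDer, associator_apply] at *
  grind

theorem innerDer_mul (halt₁ : ∀ a b : A, a * a * b = a * (a * b))
    (halt₂ : ∀ a b : A, b * a * a = b * (a * a)) (y z a b : A) :
    innerDer y z (a * b) = innerDer y z a * b + a * innerDer y z b := by
  have L := associator_swap_left halt₁
  have R := associator_swap_right halt₂
  have key : associator y z (a * b) = associator y z a * b + a * associator y z b
      - associator (y * z) a b + associator (z * y) a b := by
    have t1 := associator_cocycle a y z b
    have t2 := associator_cocycle a z y b
    have t3 := associator_cocycle z a y b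
    have t4 := associator_cocycle a z b y
    have t5 := associator_cocycle z a b y
    simp only [L a y z, L a z b, L a z (b * y), L a z y, L a z (y * b), L (a * b) y z, L (a * b)
      z y, L (a * y) z b, L b y z, L b z y, L (b * y) a z, L y z b, L (y * b) a z, L (y * z) a
      b, L (z * b) a y, L (z * y) a b, R a b y, R a b z, R a (b * y) z, R a y z, R a (y * b) z,
      R a (z * b) y, R (a * b) y z, R (a * y) b z, R (a * z) b y, R b y z, R y a z, R y (a * b)
      z, R y b z, R (z * a) b y,
      mul_neg, neg_mul] at t1 t2 t3 t4 t5 ⊢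
    clear L R halt₁ halt₂
    grind
  have u1 := L a (y * z) b
  have u2 := R a b (y * z)
  have u3 := L a (z * y) b
  have u4 := R a b (z * y)
  simp only [innerDer_eq_associator halt₁ halt₂]
  simp only [associator_apply, mul_add, add_mul, mul_sub, sub_mul, smul_mul_assoc, mul_smul_comm] at *
  grind

theorem innerDer_add (y z a b : A) :
    innerDer y z (a + b) = innerDer y z a + innerDer y z b := by
  simp only [innerDer, mul_add, add_mul]
  abel

theorem innerDer_star [StarRing A] (halt₁ : ∀ a b : A, a * a * b = a * (a * b))
    (halt₂ : ∀ a b : A, b * a * a = b * (a * a)) {y z : A}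
    (hy : star y = y) (hz : star z = z) (a : A) :
    innerDer y z (star a) = star (innerDer y z a) := by
  have h1 := associator_swap_left halt₁ y (star a) z
  have h2 := associator_swap_left halt₁ z (star a) y
  have h3 := associator_swap_right halt₂ (star a) y z
  simp only [innerDer, associator_apply, star_add, star_sub, star_mul, hy, hz] at *
  grind

theorem eq_of_two_nsmul_sub [IsAddTorsionFree A] {z w : A} (h : 2 • (z - w) = 0) : w = z := by
  rw [smul_eq_zero, sub_eq_zero] at h
  exact (h.resolve_left two_ne_zero).symm

theorem mul_mul_idem (halt₁ : ∀ a b : A, a * a * b = a * (a * b)) {e : A} (he : e * e = e)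
    (x : A) : e * (e * x) = e * x := by
  rw [← halt₁, he]

theorem mul_idem_mul (halt₂ : ∀ a b : A, b * a * a = b * (a * a)) {e : A} (he : e * e = e)
    (x : A) : x * e * e = x * e := by
  rw [halt₂, he]

theorem flexible (halt₁ : ∀ a b : A, a * a * b = a * (a * b))
    (halt₂ : ∀ a b : A, b * a * a = b * (a * a)) (e x : A) :
    e * x * e = e * (x * e) := by
  have h1 := associator_swap_left halt₁ e x e
  have h2 := halt₂ e x
  rw [associator_apply, associator_apply, h2, sub_self] at h1
  rw [← sub_eq_zero, ← neg_eq_zero, ← h1]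

namespace Peirce

variable {e x y : A} {i j k l : ℤ}

theorem zero : Peirce e i j (0 : A) := by simp [Peirce]

theorem add (hx : Peirce e i j x) (hy : Peirce e i j y) : Peirce e i j (x + y) := by
  simp [Peirce, mul_add, add_mul, hx.1, hx.2, hy.1, hy.2]

theorem sub (hx : Peirce e i j x) (hy : Peirce e i j y) : Peirce e i j (x - y) := by
  simp [Peirce, mul_sub, sub_mul, hx.1, hx.2, hy.1, hy.2, smul_sub]

theorem star_swap [StarRing A] (he : star e = e) (hx : Peirce e i j x) :
    Peirce e j i (star x) := by
  constructor
  · nth_rw 1 [← he]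
    rw [← star_mul, hx.2, star_zsmul]
  · nth_rw 1 [← he]
    rw [← star_mul, hx.1, star_zsmul]

theorem one_sub (hx : Peirce e i j x) : Peirce (1 - e) (1 - i) (1 - j) x := by
  simp [Peirce, sub_mul, mul_sub, hx.1, hx.2, sub_smul]

theorem mul (halt₁ : ∀ a b : A, a * a * b = a * (a * b))
    (halt₂ : ∀ a b : A, b * a * a = b * (a * a))
    (hx : Peirce e i j x) (hy : Peirce e k l y) :
    Peirce e (i + j - k) (l - j + k) (x * y) := by
  have h1 := associator_swap_left halt₁ e x y
  have h2 := associator_swap_right halt₂ x e y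
  simp only [associator_apply, hx.1, hx.2, hy.1, hy.2, smul_mul_assoc, mul_smul_comm] at h1 h2
  constructor
  · rw [sub_smul, add_smul]
    grind
  · rw [add_smul, sub_smul]
    grind

theorem eq_zero_of_left [IsAddTorsionFree A] (halt₁ : ∀ a b : A, a * a * b = a * (a * b))
    (he : e * e = e) (hx : Peirce e i j x) (h : i * i ≠ i) : x = 0 := by
  have h1 := mul_mul_idem halt₁ he x
  rw [hx.1, mul_smul_comm, hx.1, smul_smul, ← sub_eq_zero, ← sub_smul, smul_eq_zero] at h1
  exact h1.resolve_left (sub_ne_zero.2 h)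

theorem eq_zero_of_right [IsAddTorsionFree A] (halt₂ : ∀ a b : A, b * a * a = b * (a * a))
    (he : e * e = e) (hx : Peirce e i j x) (h : j * j ≠ j) : x = 0 := by
  have h1 := mul_idem_mul halt₂ he x
  rw [hx.2, smul_mul_assoc, hx.2, smul_smul, ← sub_eq_zero, ← sub_smul, smul_eq_zero] at h1
  exact h1.resolve_left (sub_ne_zero.2 h)

theorem eq_zero_of_ne_left [IsAddTorsionFree A] (hx : Peirce e i j x) (hx' : Peirce e k l x)
    (h : i ≠ k) : x = 0 := by
  have h1 := hx.1.symm.trans hx'.1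
  rw [← sub_eq_zero, ← sub_smul, smul_eq_zero] at h1
  exact h1.resolve_left (sub_ne_zero.2 h)

theorem exists_decomposition (halt₁ : ∀ a b : A, a * a * b = a * (a * b))
    (halt₂ : ∀ a b : A, b * a * a = b * (a * a)) (he : e * e = e) (x : A) :
    ∃ x₁₁ x₁₂ x₂₁ x₂₂ : A, Peirce e 1 1 x₁₁ ∧ Peirce e 1 0 x₁₂ ∧ Peirce e 0 1 x₂₁ ∧
      Peirce e 0 0 x₂₂ ∧ x = x₁₁ + x₂₂ + (x₁₂ + x₂₁) := by
  have h1 := mul_mul_idem halt₁ he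
  have h2 := mul_idem_mul halt₂ he
  have h3 := flexible halt₁ halt₂ e
  refine ⟨e * (x * e), e * x - e * (x * e), x * e - e * (x * e),
    x - e * x - x * e + e * (x * e), ?_, ?_, ?_, ?_, by abel⟩ <;>
  simp [Peirce, mul_sub, sub_mul, mul_add, add_mul, h1, h2, h3]

/-- An element of `A₁₁` annihilating `A₁₂` vanishes. -/
theorem eq_zero_of_mul_eq_zero [IsAddTorsionFree A] (halt₁ : ∀ a b : A, a * a * b = a * (a * b))
    (halt₂ : ∀ a b : A, b * a * a = b * (a * a)) (he : e * e = e)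
    (hcl : ∀ x : A, (∀ r : A, x * r * (1 - e) = 0) → x = 0)
    (hx : Peirce e 1 1 x) (h : ∀ r, Peirce e 1 0 r → x * r = 0) : x = 0 := by
  refine hcl x fun r => ?_
  obtain ⟨r₁₁, r₁₂, r₂₁, r₂₂, h₁₁, h₁₂, h₂₁, h₂₂, rfl⟩ :=
    exists_decomposition halt₁ halt₂ he r
  have k₁ := (hx.mul halt₁ halt₂ h₁₁).2
  have k₂ := (hx.mul halt₁ halt₂ h₂₁).eq_zero_of_left halt₁ he (by norm_num)
  have k₃ := (hx.mul halt₁ halt₂ h₂₂).eq_zero_of_left halt₁ he (by norm_num)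
  norm_num at k₁
  simp [mul_add, h _ h₁₂, k₂, k₃, mul_sub, k₁]

theorem offdiag {b c : A} (hb : Peirce e 1 0 b) (hc : Peirce e 0 1 c) :
    e * (b + c) + (b + c) * e = b + c := by
  simp [mul_add, add_mul, hb.1, hb.2, hc.1, hc.2]

theorem self_one_one (he : e * e = e) : Peirce e 1 1 e := by simp [Peirce, he]

end Peirce

end Alternative

/-- The deviation of `Φ` from additivity. -/
def addDefect {A : Type*} [NonAssocRing A] (Φ : A → A) (x y : A) : A :=
  Φ (x + y) - Φ x - Φ y

section Defect

variable {A : Type*} [NonAssocRing A] {Φ : A → A}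

theorem addDefect_zero_left (h0 : Φ 0 = 0) (x : A) : addDefect Φ 0 x = 0 := by
  simp [addDefect, h0]

theorem addDefect_zero_right (h0 : Φ 0 = 0) (x : A) : addDefect Φ x 0 = 0 := by
  simp [addDefect, h0]

theorem addDefect_eq_zero_iff {x y : A} :
    addDefect Φ x y = 0 ↔ Φ (x + y) = Φ x + Φ y := by
  rw [addDefect, sub_sub, sub_eq_zero]

end Defect

section Additivity

variable {A : Type*} [NonAssocRing A] [StarRing A]

theorem starJordan_zero_left (x : A) : starJordan 0 x = 0 := by simp [starJordan]

theorem starJordan_zero_right (x : A) : starJordan x 0 = 0 := by simp [starJordan]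

theorem starJordan_add_left (x y z : A) :
    starJordan (x + y) z = starJordan x z + starJordan y z := by
  simp only [starJordan, star_add, add_mul, mul_add]
  abel

theorem starJordan_add_right (x y z : A) :
    starJordan x (y + z) = starJordan x y + starJordan x z := by
  simp only [starJordan, add_mul, mul_add]
  abel

theorem starJordan_sub_left (x y z : A) :
    starJordan (x - y) z = starJordan x z - starJordan y z := by
  simp only [starJordan, star_sub, sub_mul, mul_sub]
  abel

theorem starJordan_sub_right (x y z : A) :
    starJordan x (y - z) = starJordan x y - starJordan x z := by
  simp only [starJordan, sub_mul, mul_sub]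
  abel

theorem starJordan_nsmul_left (n : ℕ) (x y : A) :
    starJordan (n • x) y = n • starJordan x y := by
  simp only [starJordan, star_nsmul, smul_mul_assoc, mul_smul_comm, smul_add]

theorem starJordan_nsmul_right (n : ℕ) (x y : A) :
    starJordan x (n • y) = n • starJordan x y := by
  simp only [starJordan, smul_mul_assoc, mul_smul_comm, smul_add]

theorem starJordan_one_left (x : A) : starJordan 1 x = 2 • x := by
  rw [starJordan, star_one, one_mul, mul_one, two_nsmul]

theorem starJordan_one_right (x : A) : starJordan x 1 = x + star x := by
  simp [starJordan]

theorem Peirce.starJordan_left {e x : A} {i j : ℤ} (hse : star e = e) (hx : Peirce e i j x) :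
    starJordan e x = (i + j) • x := by
  rw [starJordan, hse, hx.1, hx.2, add_smul]

theorem starJordan_left_of_star {e : A} (hse : star e = e) (x : A) :
    starJordan e x = e * x + x * e := by
  rw [starJordan, hse]

/-- The deviation of `Φ` from additivity is compatible with the product `•` in both slots. -/
structure DefectCompatible (Φ : A → A) : Prop where
  map_zero : Φ 0 = 0
  left : ∀ x y z, starJordan x (addDefect Φ y z) = addDefect Φ (starJordan x y) (starJordan x z)
  right : ∀ x y z, starJordan (addDefect Φ x y) z = addDefect Φ (starJordan x z) (starJordan y z)

namespace DefectCompatible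

variable {Φ : A → A} {e : A}

theorem mul_add_mul_of_left (hΦ : DefectCompatible Φ) (hse : star e = e) {x y : A}
    (h : addDefect Φ (starJordan e x) (starJordan e y) = 0) :
    e * addDefect Φ x y + addDefect Φ x y * e = 0 := by
  rw [← starJordan_left_of_star hse, hΦ.left, h]

variable [IsAddTorsionFree A]

/-- Multiplication by `e - (1 - e)` shows that the defect has no diagonal part. -/
theorem defect_offdiag_sum (hΦ : DefectCompatible Φ) (hse : star e = e) {x y : A}
    (hy : e * y + y * e = y) :
    e * addDefect Φ x y + addDefect Φ x y * e = addDefect Φ x y := by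
  have h1 := hΦ.left (e + e - 1) x y
  have h2 : starJordan (e + e - 1) y = 0 := by
    simp only [starJordan, star_sub, star_add, star_one, hse, sub_mul, mul_sub, add_mul, mul_add,
      one_mul, mul_one]
    grind
  rw [h2, addDefect_zero_right hΦ.map_zero] at h1
  refine eq_of_two_nsmul_sub (neg_injective ?_)
  rw [neg_zero, ← h1]
  simp only [starJordan, star_sub, star_add, star_one, hse, sub_mul, mul_sub, add_mul, mul_add,
    one_mul, mul_one, two_nsmul]
  abel

theorem defect_offdiag (hΦ : DefectCompatible Φ)
    (halt₁ : ∀ a b : A, a * a * b = a * (a * b)) (he : e * e = e) (hse : star e = e) {b c : A}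
    (hb : Peirce e 1 0 b) (hc : Peirce e 0 1 c) : addDefect Φ b c = 0 := by
  have h := hΦ.defect_offdiag_sum hse (x := b) (y := c) (by simp [hc.1, hc.2])
  have h1 := hΦ.right b c e
  have h2 := hΦ.right b c (1 - e)
  have hb' : starJordan b e = 0 := by simp [starJordan, hb.2, (hb.star_swap hse).1]
  have hc' : starJordan c (1 - e) = 0 := by
    simp [starJordan, sub_mul, mul_sub, hc.2, (hc.star_swap hse).1]
  rw [hb', addDefect_zero_left hΦ.map_zero] at h1
  rw [hc', addDefect_zero_right hΦ.map_zero] at h2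
  generalize addDefect Φ b c = Z at *
  simp only [starJordan, mul_sub, sub_mul, mul_one, one_mul] at h1 h2
  have k1 := congrArg (e * ·) h
  have k2 := congrArg (e * ·) h1
  simp only [mul_add, mul_mul_idem halt₁ he, mul_zero] at k1 k2
  have k3 : e * star Z = 0 := by grind
  have k4 : star Z = -Z := by grind
  rw [k4, mul_neg, neg_eq_zero] at k3
  grind

theorem defect_diag (hΦ : DefectCompatible Φ) (hse : star e = e) {a d : A}
    (ha : Peirce e 1 1 a) (hd : Peirce e 0 0 d) : addDefect Φ a d = 0 := by
  have h1 := hΦ.mul_add_mul_of_left hse (x := a) (y := d) (by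
    rw [hd.starJordan_left hse]
    simp [addDefect_zero_right hΦ.map_zero])
  have hse' : star (1 - e) = 1 - e := by simp [hse]
  have h2 := hΦ.mul_add_mul_of_left hse' (x := a) (y := d) (by
    rw [ha.one_sub.starJordan_left hse']
    simp [addDefect_zero_left hΦ.map_zero])
  refine eq_of_two_nsmul_sub (z := addDefect Φ a d) (w := 0) ?_ |>.symm
  simp only [sub_mul, mul_sub, one_mul, mul_one, two_nsmul] at *
  grind

theorem defect_diag_offdiag_aux (hΦ : DefectCompatible Φ) (hse : star e = e) {a b c : A}
    (ha : Peirce e 1 1 a) (hb : Peirce e 1 0 b) (hc : Peirce e 0 1 c) :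
    addDefect Φ a (b + c) = 0 := by
  have h := hΦ.defect_offdiag_sum hse (x := a) (Peirce.offdiag hb hc)
  have hse' : star (1 - e) = 1 - e := by simp [hse]
  have h2 := hΦ.mul_add_mul_of_left hse' (x := a) (y := b + c) (by
    rw [ha.one_sub.starJordan_left hse']
    simp [addDefect_zero_left hΦ.map_zero])
  simp only [sub_mul, mul_sub, one_mul, mul_one] at h2
  grind

theorem defect_diag_offdiag (hΦ : DefectCompatible Φ) (hse : star e = e) {a b c d : A}
    (ha : Peirce e 1 1 a) (hd : Peirce e 0 0 d) (hb : Peirce e 1 0 b) (hc : Peirce e 0 1 c) :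
    addDefect Φ (a + d) (b + c) = 0 := by
  rw [← hΦ.defect_offdiag_sum hse (x := a + d) (Peirce.offdiag hb hc)]
  refine hΦ.mul_add_mul_of_left hse ?_
  rw [starJordan_add_right, ha.starJordan_left hse, hd.starJordan_left hse,
    starJordan_left_of_star hse, Peirce.offdiag hb hc]
  simp only [add_smul, one_smul, zero_smul, add_zero]
  exact hΦ.defect_diag_offdiag_aux hse (ha.add ha) hb hc

theorem map_peirce_sum (hΦ : DefectCompatible Φ)
    (halt₁ : ∀ a b : A, a * a * b = a * (a * b)) (he : e * e = e) (hse : star e = e) {a b c d : A}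
    (ha : Peirce e 1 1 a) (hd : Peirce e 0 0 d) (hb : Peirce e 1 0 b) (hc : Peirce e 0 1 c) :
    Φ (a + d + (b + c)) = Φ a + Φ d + (Φ b + Φ c) := by
  rw [addDefect_eq_zero_iff.1 (hΦ.defect_diag_offdiag hse ha hd hb hc),
    addDefect_eq_zero_iff.1 (hΦ.defect_diag hse ha hd),
    addDefect_eq_zero_iff.1 (hΦ.defect_offdiag halt₁ he hse hb hc)]

theorem peirce_defect_upper (hΦ : DefectCompatible Φ)
    (halt₁ : ∀ a b : A, a * a * b = a * (a * b)) (he : e * e = e) (hse : star e = e) {b b' : A}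
    (hb : Peirce e 1 0 b) (hb' : Peirce e 1 0 b') : Peirce e 1 0 (addDefect Φ b b') := by
  have h := hΦ.defect_offdiag_sum hse (x := b) (y := b') (by simp [hb'.1, hb'.2])
  have h1 := hΦ.right b b' e
  have hb₀ : starJordan b e = 0 := by simp [starJordan, hb.2, (hb.star_swap hse).1]
  rw [hb₀, addDefect_zero_left hΦ.map_zero] at h1
  generalize addDefect Φ b b' = Z at *
  have k1 := congrArg (e * ·) h
  have k2 := congrArg (e * ·) h1
  simp only [starJordan, mul_add, mul_mul_idem halt₁ he, mul_zero] at h1 k1 k2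
  have k3 : Z * e = 0 := by grind
  exact ⟨by rw [one_smul]; grind, by simp [k3]⟩

theorem peirce_defect_lower (hΦ : DefectCompatible Φ)
    (halt₁ : ∀ a b : A, a * a * b = a * (a * b)) (he : e * e = e) (hse : star e = e) {c c' : A}
    (hc : Peirce e 0 1 c) (hc' : Peirce e 0 1 c') : Peirce e 0 1 (addDefect Φ c c') := by
  have he' : (1 - e) * (1 - e) = 1 - e := by simp [sub_mul, mul_sub, he]
  simpa using (hΦ.peirce_defect_upper halt₁ he' (by simp [hse]) hc.one_sub hc'.one_sub).one_sub

theorem defect_upper (hΦ : DefectCompatible Φ)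
    (halt₁ : ∀ a b : A, a * a * b = a * (a * b)) (halt₂ : ∀ a b : A, b * a * a = b * (a * a))
    (he : e * e = e) (hse : star e = e) {b b' : A}
    (hb : Peirce e 1 0 b) (hb' : Peirce e 1 0 b') : addDefect Φ b b' = 0 := by
  have he' : (1 - e) * (1 - e) = 1 - e := by simp [sub_mul, mul_sub, he]
  have hse' : star (1 - e) = 1 - e := by simp [hse]
  have hbs := hb.star_swap hse
  have hb's := hb'.star_swap hse
  have hp := hb'.mul halt₁ halt₂ hbs
  have hq := hb.mul halt₁ halt₂ hb'
  norm_num at hp hq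
  have h0 : addDefect Φ (1 - e) b' = 0 := by
    simpa using hΦ.defect_diag_offdiag_aux hse' (Peirce.self_one_one he') Peirce.zero hb'.one_sub
  have h1 := hΦ.left (e + b) (1 - e) b'
  have e1 : starJordan (e + b) (1 - e) = b + star b := by
    simp [starJordan, hse, add_mul, mul_add, mul_sub, sub_mul, he, hb.2, hbs.1]
  have e2 : starJordan (e + b) b' = b' * star b + 0 + (b' + b * b') := by
    simp [starJordan, hse, add_mul, mul_add, hb'.1, hb'.2]
    abel
  rw [h0, starJordan_zero_right, e1, e2, eq_comm, addDefect_eq_zero_iff,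
    addDefect_eq_zero_iff.1 (hΦ.defect_offdiag halt₁ he hse hb hbs),
    hΦ.map_peirce_sum halt₁ he hse hp Peirce.zero hb' hq,
    show b + star b + (b' * star b + 0 + (b' + b * b')) =
      b' * star b + 0 + ((b + b') + (star b + b * b')) by abel,
    hΦ.map_peirce_sum halt₁ he hse hp Peirce.zero (hb.add hb') (hbs.add hq)] at h1
  have k1 := hΦ.peirce_defect_upper halt₁ he hse hb hb'
  have k2 := hΦ.peirce_defect_lower halt₁ he hse hbs hq
  have k3 : addDefect Φ b b' = 0 - addDefect Φ (star b) (b * b') := by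
    simp only [addDefect]
    grind
  exact k1.eq_zero_of_ne_left (k3 ▸ Peirce.zero.sub k2) one_ne_zero

theorem defect_corner (hΦ : DefectCompatible Φ)
    (halt₁ : ∀ a b : A, a * a * b = a * (a * b)) (halt₂ : ∀ a b : A, b * a * a = b * (a * a))
    (he : e * e = e) (hse : star e = e)
    (hcl : ∀ x : A, (∀ r : A, x * r * (1 - e) = 0) → x = 0) {a a' : A}
    (ha : Peirce e 1 1 a) (ha' : Peirce e 1 1 a') : addDefect Φ a a' = 0 := by
  have hse' : star (1 - e) = 1 - e := by simp [hse]
  have h2 := hΦ.mul_add_mul_of_left hse' (x := a) (y := a') (by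
    rw [ha.one_sub.starJordan_left hse']
    simp [addDefect_zero_left hΦ.map_zero])
  have hZ : Peirce e 1 1 (addDefect Φ a a') := by
    generalize addDefect Φ a a' = Z at *
    have k1 := congrArg (e * ·) h2
    have k2 := congrArg (· * e) h2
    simp only [sub_mul, mul_sub, add_mul, mul_add, one_mul, mul_one, mul_zero, zero_mul,
      mul_mul_idem halt₁ he, mul_idem_mul halt₂ he, flexible halt₁ halt₂] at h2 k1 k2
    have k3 : e * Z = Z := (eq_of_two_nsmul_sub (by rw [two_nsmul]; grind))
    simp only [Peirce, one_smul]
    grind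
  refine hZ.eq_zero_of_mul_eq_zero halt₁ halt₂ he hcl fun r hr => ?_
  have h3 := hΦ.right a a' r
  have key : ∀ x, Peirce e 1 1 x → r * star x = 0 := fun x hx =>
    (hr.mul halt₁ halt₂ (hx.star_swap hse)).eq_zero_of_right halt₂ he (by norm_num)
  have key' : ∀ x, Peirce e 1 1 x → Peirce e 1 0 (x * r) := fun x hx => by
    simpa using hx.mul halt₁ halt₂ hr
  simp only [starJordan, key _ ha, key _ ha', key _ hZ, add_zero] at h3
  rw [h3, hΦ.defect_upper halt₁ halt₂ he hse (key' _ ha) (key' _ ha')]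

theorem map_add (hΦ : DefectCompatible Φ)
    (halt₁ : ∀ a b : A, a * a * b = a * (a * b)) (halt₂ : ∀ a b : A, b * a * a = b * (a * a))
    (he : e * e = e) (hse : star e = e)
    (hsp : ∀ x : A, (∀ r : A, x * r * e = 0) → x = 0)
    (hcl : ∀ x : A, (∀ r : A, x * r * (1 - e) = 0) → x = 0) (x y : A) :
    Φ (x + y) = Φ x + Φ y := by
  have he' : (1 - e) * (1 - e) = 1 - e := by simp [sub_mul, mul_sub, he]
  have hse' : star (1 - e) = 1 - e := by simp [hse]
  obtain ⟨a, b, c, d, ha, hb, hc, hd, rfl⟩ := Peirce.exists_decomposition halt₁ halt₂ he x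
  obtain ⟨a', b', c', d', ha', hb', hc', hd', rfl⟩ := Peirce.exists_decomposition halt₁ halt₂ he y
  rw [show a + d + (b + c) + (a' + d' + (b' + c')) =
      (a + a') + (d + d') + ((b + b') + (c + c')) by abel,
    hΦ.map_peirce_sum halt₁ he hse (ha.add ha') (hd.add hd') (hb.add hb') (hc.add hc'),
    hΦ.map_peirce_sum halt₁ he hse ha hd hb hc, hΦ.map_peirce_sum halt₁ he hse ha' hd' hb' hc',
    addDefect_eq_zero_iff.1 (hΦ.defect_corner halt₁ halt₂ he hse hcl ha ha'),
    addDefect_eq_zero_iff.1 (hΦ.defect_corner halt₁ halt₂ he' hse' (by simpa using hsp)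
      (by simpa using hd.one_sub) (by simpa using hd'.one_sub)),
    addDefect_eq_zero_iff.1 (hΦ.defect_upper halt₁ halt₂ he hse hb hb'),
    addDefect_eq_zero_iff.1 (hΦ.defect_upper halt₁ halt₂ he' hse' (by simpa using hc.one_sub)
      (by simpa using hc'.one_sub))]
  abel

end DefectCompatible

end Additivity

section Reduction

variable {A : Type*} [NonAssocRing A]

theorem ofFn_lastTwoFamily (N : ℕ) (x y : A) :
    List.ofFn (lastTwoFamily (N + 2) x y) = List.replicate N 1 ++ [x, y] := by
  refine List.ext_getElem (by simp) fun i h1 h2 => ?_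
  simp only [List.getElem_ofFn, lastTwoFamily, List.getElem_append, List.length_replicate,
    List.getElem_replicate]
  simp only [List.length_ofFn] at h1
  by_cases h : i < N
  · simp [h, h.ne, show i ≠ N + 1 by omega]
  · obtain rfl | rfl : i = N ∨ i = N + 1 := by omega
    · simp
    · simp

theorem ofFn_update_lastTwoFamily (N : ℕ) (x y v : A) (k : Fin N) :
    List.ofFn (Function.update (lastTwoFamily (N + 2) x y) k.castSucc.castSucc v) =
      List.replicate k 1 ++ v :: List.replicate (N - 1 - k) 1 ++ [x, y] := by
  have hk := k.2
  refine List.ext_getElem (by simp; omega) fun i h1 h2 => ?_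
  simp only [List.getElem_ofFn, lastTwoFamily, List.getElem_append, List.length_replicate,
    List.getElem_replicate, Function.update_apply, Fin.ext_iff, List.length_append,
    List.length_cons, List.getElem_cons, Fin.val_castSucc]
  simp only [List.length_ofFn] at h1
  by_cases h : i < N
  · split_ifs <;> first | rfl | omega
  · obtain rfl | rfl : i = N ∨ i = N + 1 := by omega
    · grind
    · grind

theorem update_lastTwoFamily_last_castSucc (N : ℕ) (x y v : A) :
    Function.update (lastTwoFamily (N + 2) x y) (Fin.last N).castSucc v =
      lastTwoFamily (N + 2) v y := by
  ext i
  simp only [Function.update_apply, lastTwoFamily, Fin.ext_iff, Fin.val_castSucc, Fin.val_last]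
  grind

theorem update_lastTwoFamily_last (N : ℕ) (x y v : A) :
    Function.update (lastTwoFamily (N + 2) x y) (Fin.last (N + 1)) v =
      lastTwoFamily (N + 2) x v := by
  ext i
  simp only [Function.update_apply, lastTwoFamily, Fin.ext_iff, Fin.val_last]
  grind

variable [StarRing A]

theorem leftStarJordan_append_pair {l : List A} (hl : l ≠ []) (x y : A) :
    leftStarJordan (l ++ [x, y]) = starJordan (starJordan (leftStarJordan l) x) y := by
  cases l with
  | nil => exact absurd rfl hl
  | cons a l => simp [leftStarJordan, List.foldl_append]

theorem foldl_starJordan_one (k : ℕ) (m : ℕ) :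
    (List.replicate k (1 : A)).foldl starJordan (m • 1) = (2 ^ k * m) • 1 := by
  induction k generalizing m with
  | zero => simp
  | succ k ih =>
    rw [List.replicate_succ, List.foldl_cons, starJordan_nsmul_left, starJordan_one_left,
      smul_smul, ih, pow_succ, mul_assoc, mul_comm m]

theorem leftStarJordan_replicate_one (N : ℕ) :
    leftStarJordan (List.replicate (N + 1) (1 : A)) = 2 ^ N • 1 := by
  simpa [leftStarJordan, List.replicate_succ] using foldl_starJordan_one (A := A) N 1

theorem leftStarJordan_lastTwoFamily (N : ℕ) (x y : A) :
    leftStarJordan (List.ofFn (lastTwoFamily (N + 2) x y)) = 2 ^ N • starJordan x y := by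
  rw [ofFn_lastTwoFamily]
  cases N with
  | zero => simp [leftStarJordan]
  | succ N =>
    rw [leftStarJordan_append_pair (by simp), leftStarJordan_replicate_one, starJordan_nsmul_left,
      starJordan_one_left, smul_smul, starJordan_nsmul_left, pow_succ]

theorem exists_foldl_starJordan_replicate_one (m : ℕ) (T : A) (a b : ℕ) :
    ∃ α β : ℕ, (List.replicate m (1 : A)).foldl starJordan (a • T + b • star T) =
      α • T + β • star T := by
  induction m generalizing a b with
  | zero => exact ⟨a, b, rfl⟩
  | succ m ih =>
    obtain ⟨α, β, h⟩ := ih (a + b) (a + b)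
    refine ⟨α, β, ?_⟩
    rw [List.replicate_succ, List.foldl_cons, ← h, starJordan_one_right]
    congr 1
    simp only [star_add, star_nsmul, star_star, add_smul]
    abel

theorem exists_leftStarJordan_replicate_one (k m : ℕ) (T : A) :
    ∃ α β : ℕ, leftStarJordan (List.replicate k (1 : A) ++ T :: List.replicate m 1) =
      α • T + β • star T := by
  cases k with
  | zero => simpa [leftStarJordan] using exists_foldl_starJordan_replicate_one m T 1 0
  | succ k =>
    obtain ⟨α, β, h⟩ := exists_foldl_starJordan_replicate_one m T (2 ^ (k + 1)) 0
    refine ⟨α, β, ?_⟩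
    rw [← h, zero_smul, add_zero]
    simp only [leftStarJordan, List.replicate_succ, List.cons_append, List.foldl_append,
      List.foldl_cons]
    have h1 := foldl_starJordan_one (A := A) k 1
    rw [one_smul, mul_one] at h1
    rw [h1, starJordan_nsmul_left, starJordan_one_left, smul_smul, pow_succ]

/-- The `n`-fold identity in the last two slots, rewritten as a binary identity. -/
theorem exists_binary_identity (N : ℕ) (Φ : A → A)
    (hΦ : ∀ x y : A,
      Φ (leftStarJordan (List.ofFn (lastTwoFamily (N + 2) x y))) =
        ∑ k : Fin (N + 2), leftStarJordan (List.ofFn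
          (Function.update (lastTwoFamily (N + 2) x y) k (Φ (lastTwoFamily (N + 2) x y k))))) :
    ∃ α β : ℕ, ∀ x y : A, Φ (2 ^ N • starJordan x y) =
      starJordan (starJordan (α • Φ 1 + β • star (Φ 1)) x) y + 2 ^ N • starJordan (Φ x) y +
        2 ^ N • starJordan x (Φ y) := by
  choose α β h using fun k : Fin N => exists_leftStarJordan_replicate_one k (N - 1 - k) (Φ 1)
  refine ⟨∑ k, α k, ∑ k, β k, fun x y => ?_⟩
  have hx : lastTwoFamily (N + 2) x y (Fin.last N).castSucc = x := by simp [lastTwoFamily]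
  have hy : lastTwoFamily (N + 2) x y (Fin.last (N + 1)) = y := by simp [lastTwoFamily]
  have h1 (k : Fin N) : lastTwoFamily (N + 2) x y k.castSucc.castSucc = 1 := by
    have hk := k.2
    simp [lastTwoFamily, hk.ne, show (k : ℕ) ≠ N + 1 by omega]
  rw [← leftStarJordan_lastTwoFamily, hΦ, Fin.sum_univ_castSucc, Fin.sum_univ_castSucc, hx, hy,
    update_lastTwoFamily_last_castSucc, update_lastTwoFamily_last, leftStarJordan_lastTwoFamily,
    leftStarJordan_lastTwoFamily]
  congr 2
  let g : A →+ A := AddMonoidHom.mk' (fun c => starJordan (starJordan c x) y) fun c d => by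
    simp only [starJordan_add_left]
  rw [Finset.sum_smul, Finset.sum_smul, ← Finset.sum_add_distrib]
  refine Eq.trans (Finset.sum_congr rfl fun k _ => ?_) (map_sum g _ _).symm
  rw [h1, ofFn_update_lastTwoFamily, leftStarJordan_append_pair (by simp), h]
  rfl

/-- A map satisfying the binary identity has an additivity defect compatible with `•`. -/
theorem defectCompatible_of_binary_identity {Φ : A → A} {q : ℕ}
    (hdiv : ∀ x : A, ∃ z, q • z = x) {C : A}
    (h : ∀ x y : A, Φ (q • starJordan x y) =
      starJordan (starJordan C x) y + q • starJordan (Φ x) y + q • starJordan x (Φ y)) :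
    DefectCompatible Φ where
  map_zero := by simpa [starJordan_zero_left, starJordan_zero_right] using h 0 0
  left x y z := by
    obtain ⟨x, rfl⟩ := hdiv x
    simp only [addDefect, ← starJordan_add_right, starJordan_nsmul_left, ← smul_add, h]
    simp only [starJordan_add_right, starJordan_sub_right, smul_add, smul_sub]
    abel
  right x y z := by
    obtain ⟨z, rfl⟩ := hdiv z
    simp only [addDefect, ← starJordan_add_left, starJordan_nsmul_right, ← smul_add, h]
    simp only [starJordan_add_right, starJordan_add_left, starJordan_sub_left, smul_add, smul_sub]
    abel

/-- An additive map satisfying the binary identity is a Jordan `•`-derivation. -/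
theorem starJordan_derivation_of_binary_identity [IsAddTorsionFree A] {Φ : A → A} {q : ℕ}
    (hq : q ≠ 0) {α β : ℕ}
    (h : ∀ x y : A, Φ (q • starJordan x y) =
      starJordan (starJordan (α • Φ 1 + β • star (Φ 1)) x) y + q • starJordan (Φ x) y +
        q • starJordan x (Φ y)) (hadd : ∀ x y, Φ (x + y) = Φ x + Φ y) (x y : A) :
    Φ (starJordan x y) = starJordan (Φ x) y + starJordan x (Φ y) := by
  have hsmul (m : ℕ) (z : A) : Φ (m • z) = m • Φ z := map_nsmul (AddMonoidHom.mk' Φ hadd) m z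
  have h1 (y : A) : starJordan (starJordan (α • Φ 1 + β • star (Φ 1)) 1) y +
      q • starJordan (Φ 1) y = 0 := by
    have := h 1 y
    rw [starJordan_one_left, starJordan_one_left, hsmul, hsmul] at this
    simpa using this
  have hS : Φ 1 + star (Φ 1) = 0 := by
    have h2 := h1 1
    simp only [starJordan_one_right, star_add, star_nsmul, star_star] at h2
    have h3 : (2 * (α + β) + q) • (Φ 1 + star (Φ 1)) = 0 := by
      rw [← h2]
      module
    exact (smul_eq_zero.1 h3).resolve_left (by omega)
  have hT (y : A) : starJordan (Φ 1) y = 0 := by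
    have h2 := h1 y
    have h3 : starJordan (α • Φ 1 + β • star (Φ 1)) 1 = (α + β) • (Φ 1 + star (Φ 1)) := by
      simp only [starJordan_one_right, star_add, star_nsmul, star_star]
      module
    rw [h3, hS, smul_zero, starJordan_zero_left, zero_add, smul_eq_zero] at h2
    exact h2.resolve_left hq
  have hT' (y : A) : starJordan (star (Φ 1)) y = 0 := by
    have h2 := starJordan_add_left (Φ 1) (star (Φ 1)) y
    rwa [hS, starJordan_zero_left, hT, zero_add, eq_comm] at h2
  have h4 := h x y
  rw [starJordan_add_left, starJordan_nsmul_left, starJordan_nsmul_left, hT, hT', smul_zero,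
    smul_zero, add_zero, starJordan_zero_left, zero_add, hsmul, ← smul_add, ← sub_eq_zero,
    ← smul_sub, smul_eq_zero, sub_eq_zero] at h4
  exact h4.resolve_left hq

end Reduction

section Normalized

variable {A : Type*} [NonAssocRing A] [StarRing A] {φ : A → A} {e : A}

/-- The off-diagonal and `22` parts of `Φ e`, for a Jordan `•`-derivation `Φ`. -/
theorem apply_idem_relation (hadd : ∀ x y, φ (x + y) = φ x + φ y)
    (h : ∀ x y, φ (starJordan x y) = starJordan (φ x) y + starJordan x (φ y))
    (he : e * e = e) (hse : star e = e) :
    φ e * e + e * star (φ e) + (e * φ e + φ e * e) = φ e + φ e := by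
  have h1 := h e e
  rwa [starJordan_left_of_star hse, starJordan_left_of_star hse, he, hadd, eq_comm,
    starJordan] at h1

theorem apply_idem_decomposition  [IsAddTorsionFree A]
    (hadd : ∀ x y, φ (x + y) = φ x + φ y)
    (h : ∀ x y, φ (starJordan x y) = starJordan (φ x) y + starJordan x (φ y))
    (halt₁ : ∀ a b : A, a * a * b = a * (a * b)) (halt₂ : ∀ a b : A, b * a * a = b * (a * a))
    (he : e * e = e) (hse : star e = e) :
    ∃ p b : A, Peirce e 1 1 p ∧ Peirce e 1 0 b ∧ φ e = p + (b + star b) := by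
  obtain ⟨a, b, c, d, ha, hb, hc, hd, hs⟩ := Peirce.exists_decomposition halt₁ halt₂ he (φ e)
  have h1 := apply_idem_relation hadd h he hse
  have ha' := ha.star_swap hse
  have hb' := hb.star_swap hse
  have hc' := hc.star_swap hse
  have hd' := hd.star_swap hse
  rw [hs] at h1
  simp only [mul_add, add_mul, ha.1, ha.2, hb.1, hb.2, hc.1, hc.2, hd.1, hd.2, star_add, ha'.1,
    hb'.1, hc'.1, hd'.1, one_smul, zero_smul, add_zero, zero_add] at h1
  have k : (a + star a) + (star c - b) + 0 - (d + d) = 0 := by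
    grind
  have k1 := congrArg (e * ·) k
  have k2 := congrArg (· * e) k1
  simp only [mul_add, mul_sub, add_mul, sub_mul, ha.1, ha.2, hb.1, hb.2, hd.1, ha'.1, ha'.2,
    hc'.1, hc'.2, one_smul, zero_smul, mul_zero, zero_mul] at k1 k2
  have hcb : star c = b := by grind
  have hd0 : d = 0 := eq_of_two_nsmul_sub (z := 0) (by rw [two_nsmul]; grind)
  refine ⟨a, b, ha, hb, ?_⟩
  rw [hs, hd0, ← hcb, star_star, add_zero]

/-- Vanishing on `e`, once the value there is known to lie in `A₁₁`. -/
theorem apply_idem_eq_zero  [IsAddTorsionFree A]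
    (h : ∀ x y, φ (starJordan x y) = starJordan (φ x) y + starJordan x (φ y))
    (halt₁ : ∀ a b : A, a * a * b = a * (a * b)) (halt₂ : ∀ a b : A, b * a * a = b * (a * a))
    (he : e * e = e) (hse : star e = e)
    (hcl : ∀ x : A, (∀ r : A, x * r * (1 - e) = 0) → x = 0)
    (hp : Peirce e 1 1 (φ e)) : φ e = 0 := by
  refine hp.eq_zero_of_mul_eq_zero halt₁ halt₂ he hcl fun b hb => ?_
  have h1 := h e b
  have h2 := (hb.mul halt₁ halt₂ (hp.star_swap hse)).eq_zero_of_right halt₂ he (by norm_num)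
  have h3 := hp.mul halt₁ halt₂ hb
  rw [hb.starJordan_left hse, starJordan_left_of_star hse, starJordan, h2] at h1
  norm_num at h1 h3
  have k1 := congrArg (e * ·) h1
  have k2 := congrArg (· * e) k1
  simp only [mul_add, add_mul, h3.1, h3.2, one_smul, zero_smul, mul_mul_idem halt₁ he,
    flexible halt₁ halt₂, mul_idem_mul halt₂ he] at k1 k2
  grind

theorem apply_one_sub_idem_eq_zero  [IsAddTorsionFree A]
    (hadd : ∀ x y, φ (x + y) = φ x + φ y)
    (h : ∀ x y, φ (starJordan x y) = starJordan (φ x) y + starJordan x (φ y))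
    (halt₁ : ∀ a b : A, a * a * b = a * (a * b)) (halt₂ : ∀ a b : A, b * a * a = b * (a * a))
    (he : e * e = e) (hse : star e = e)
    (hsp : ∀ x : A, (∀ r : A, x * r * e = 0) → x = 0) (h0 : φ e = 0) : φ (1 - e) = 0 := by
  have hφ0 : φ 0 = 0 := map_zero (AddMonoidHom.mk' φ hadd)
  have h1 : φ 1 = φ (1 - e) := by
    rw [← sub_add_cancel 1 e, hadd, h0, add_zero, add_sub_cancel_right]
  have hT (y : A) : starJordan (φ (1 - e)) y = 0 := by
    have h2 := h 1 y
    rw [starJordan_one_left, starJordan_one_left, two_nsmul, two_nsmul, hadd, h1] at h2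
    simpa using h2
  have he0 : starJordan e (φ (1 - e)) = 0 := by
    have h2 := h e (1 - e)
    have h3 : starJordan e (1 - e) = 0 := by
      simp [starJordan_left_of_star hse, mul_sub, sub_mul, he]
    rwa [h3, hφ0, h0, starJordan_zero_left, zero_add, eq_comm] at h2
  generalize φ (1 - e) = T at *
  have hst : star T = -T := by
    have h2 := hT 1
    rw [starJordan_one_right] at h2
    exact (neg_eq_of_add_eq_zero_right h2).symm
  have hcomm (y : A) : T * y = y * T := by
    have h2 := hT y
    rwa [starJordan, hst, mul_neg, ← sub_eq_add_neg, sub_eq_zero] at h2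
  have heT : e * T = 0 := by
    rw [starJordan_left_of_star hse, hcomm] at he0
    exact (eq_of_two_nsmul_sub (z := 0) (w := e * T) (by
      rw [two_nsmul]; grind))
  have hTP : Peirce e 0 0 T := by simp [Peirce, heT, hcomm]
  refine hsp T fun r => ?_
  obtain ⟨r₁₁, r₁₂, r₂₁, r₂₂, h₁₁, h₁₂, h₂₁, h₂₂, rfl⟩ :=
    Peirce.exists_decomposition halt₁ halt₂ he r
  have k₁ := (hTP.mul halt₁ halt₂ h₁₁).eq_zero_of_left halt₁ he (by norm_num)
  have k₂ := (hTP.mul halt₁ halt₂ h₁₂).eq_zero_of_left halt₁ he (by norm_num)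
  have k₃ := (h₂₁.mul halt₁ halt₂ hTP).eq_zero_of_right halt₂ he (by norm_num)
  have k₄ := (hTP.mul halt₁ halt₂ h₂₂).2
  rw [← hcomm] at k₃
  norm_num at k₄
  simp [mul_add, k₁, k₂, k₃, k₄]

theorem map_star_of_derivation (hadd : ∀ x y, φ (x + y) = φ x + φ y)
    (h : ∀ x y, φ (starJordan x y) = starJordan (φ x) y + starJordan x (φ y))
    (h1 : φ 1 = 0) (x : A) : φ (star x) = star (φ x) := by
  have h2 := h x 1
  rw [h1, starJordan_zero_right, add_zero, starJordan_one_right, starJordan_one_right, hadd] at h2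
  exact add_left_cancel h2

end Normalized

theorem stmt_15 {A : Type*} [NonAssocRing A] [Module ℂ A]
    [SMulCommClass ℂ A A] [IsScalarTower ℂ A A] [StarRing A]
    (halt₁ : ∀ a b : A, a * a * b = a * (a * b))
    (halt₂ : ∀ a b : A, b * a * a = b * (a * a))
    (e : A) (heStar : star e = e) (heIdem : e * e = e) (he0 : e ≠ 0) (he1 : e ≠ 1)
    (hsp : ∀ x : A, (∀ r : A, x * r * e = 0) → x = 0)
    (hcl : ∀ x : A, (∀ r : A, x * r * (1 - e) = 0) → x = 0)
    (n : ℕ) (hn : 2 ≤ n) (Φ : A → A)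
    (hΦ : ∀ x y : A,
      Φ (leftStarJordan (List.ofFn (lastTwoFamily n x y))) =
        ∑ k : Fin n, leftStarJordan (List.ofFn
          (Function.update (lastTwoFamily n x y) k (Φ (lastTwoFamily n x y k))))) :
    ∀ φ : A → A,
      (∀ a : A, φ a = Φ a -
        innerDer (e * (Φ e * (1 - e)) + (1 - e) * (Φ e * e)) e a) →
      (∀ a b : A, φ (starJordan a b) = starJordan (φ a) b + starJordan a (φ b)) ∧
      φ e = 0 ∧ φ (1 - e) = 0 ∧
      (∀ a b : A, φ (a + b) = φ a + φ b) ∧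
      (∀ a : A, φ (star a) = star (φ a)) := by
  have hdiv (q : ℕ) (hq : q ≠ 0) (x : A) : ∃ z : A, q • z = x :=
    ⟨(q : ℂ)⁻¹ • x, by
      rw [← Nat.cast_smul_eq_nsmul ℂ, smul_inv_smul₀ (Nat.cast_ne_zero.2 hq)]⟩
  have : IsAddTorsionFree A := by
    let : Module ℚ A := Module.compHom A (algebraMap ℚ ℂ)
    exact .of_module_rat A
  obtain ⟨N, rfl⟩ := Nat.exists_eq_add_of_le' hn
  obtain ⟨α, β, hbin⟩ := exists_binary_identity N Φ hΦ
  have hq : 2 ^ N ≠ 0 := by positivity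
  have hadd := (defectCompatible_of_binary_identity (hdiv _ hq) hbin).map_add halt₁ halt₂
    heIdem heStar hsp hcl
  have hder := starJordan_derivation_of_binary_identity hq hbin hadd
  obtain ⟨p, b, hp, hb, hpb⟩ := apply_idem_decomposition hadd hder halt₁ halt₂ heIdem heStar
  have hb' := hb.star_swap heStar
  intro φ hφ
  have hy : e * (Φ e * (1 - e)) + (1 - e) * (Φ e * e) = b + star b := by
    simp [hpb, mul_add, add_mul, mul_sub, sub_mul, hp.1, hp.2, hb.1, hb.2, hb'.1, hb'.2]
  rw [hy] at hφ
  have hys : star (b + star b) = b + star b := by rw [star_add, star_star, add_comm]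
  have hφadd (x y : A) : φ (x + y) = φ x + φ y := by
    rw [hφ, hφ, hφ, hadd, innerDer_add]
    abel
  have hφder (x y : A) : φ (starJordan x y) = starJordan (φ x) y + starJordan x (φ y) := by
    simp only [hφ, hder, starJordan_sub_left, starJordan_sub_right]
    simp only [starJordan, innerDer_add, innerDer_mul halt₁ halt₂,
      innerDer_star halt₁ halt₂ hys heStar]
    abel
  have hφe : φ e = p := by
    rw [hφ, hpb]
    simp [innerDer, mul_add, add_mul, heIdem, hb.1, hb.2, hb'.1, hb'.2]
    abel
  have h0 : φ e = 0 :=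
    apply_idem_eq_zero hφder halt₁ halt₂ heIdem heStar hcl (by rwa [hφe])
  have h1 := apply_one_sub_idem_eq_zero hφadd hφder halt₁ halt₂ heIdem heStar hsp h0
  have h2 : φ 1 = 0 := by rw [← sub_add_cancel 1 e, hφadd, h0, h1, add_zero]
  exact ⟨hφder, h0, h1, hφadd, map_star_of_derivation hφadd hφder h2⟩
end

section
/- Let A be a unital alternative *-algebra over ℂ containing a nontrivial symmetric idempotent e satisfying conditions (♠) and (♣), let Φ : A → A be a map satisfying the *-Jordan n-derivation identity in the last two slots, and let φ = Φ − Ξ_{y,e₁} where y = e₁(Φ(e₁)e₂) + e₂(Φ(e₁)e₁). Then φ preserves the Peirce components: for all i, j ∈ {1,2} and all a ∈ A_{ij}, one has φ(a) ∈ A_{ij}. -/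
section AlternativePeirce

variable {A : Type*} [NonAssocRing A]

/-- `x` is an eigenvector of left and right multiplication by `e`, with integer eigenvalues
`μ` and `ν`. -/
def IsPeirceEigen (e : A) (μ ν : ℤ) (x : A) : Prop :=
  e * x = μ • x ∧ x * e = ν • x

/-- The map `x ↦ a (x b)`. -/
def sandwich (a b : A) : A →+ A :=
  (AddMonoidHom.mulLeft a).comp (AddMonoidHom.mulRight b)

lemma sandwich_apply (a b x : A) : sandwich a b x = a * (x * b) := rfl

lemma inPeirce_iff {e x : A} {i j : Fin 2} :
    inPeirce e i j x ↔ IsPeirceEigen e (1 - i.val) (1 - j.val) x := by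
  fin_cases i <;> fin_cases j <;>
    simp [inPeirce, peirceIdem, IsPeirceEigen, sub_mul, mul_sub]

namespace IsPeirceEigen

variable {e x y : A} {μ ν : ℤ}

lemma add (hx : IsPeirceEigen e μ ν x) (hy : IsPeirceEigen e μ ν y) :
    IsPeirceEigen e μ ν (x + y) :=
  ⟨by rw [mul_add, hx.1, hy.1, smul_add], by rw [add_mul, hx.2, hy.2, smul_add]⟩

lemma neg (hx : IsPeirceEigen e μ ν x) : IsPeirceEigen e μ ν (-x) :=
  ⟨by rw [mul_neg, hx.1, smul_neg], by rw [neg_mul, hx.2, smul_neg]⟩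

lemma nsmul (hx : IsPeirceEigen e μ ν x) (n : ℕ) : IsPeirceEigen e μ ν (n • x) :=
  ⟨by rw [mul_smul_comm, hx.1, smul_comm], by rw [smul_mul_assoc, hx.2, smul_comm]⟩

lemma of_compl (hx : IsPeirceEigen (1 - e) μ ν x) : IsPeirceEigen e (1 - μ) (1 - ν) x := by
  obtain ⟨h₁, h₂⟩ := hx
  rw [sub_mul, one_mul, sub_eq_iff_eq_add'] at h₁
  rw [mul_sub, mul_one, sub_eq_iff_eq_add'] at h₂
  constructor
  · rw [sub_smul, one_smul]; exact eq_sub_of_add_eq h₁.symm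
  · rw [sub_smul, one_smul]; exact eq_sub_of_add_eq h₂.symm

lemma compl (hx : IsPeirceEigen e μ ν x) : IsPeirceEigen (1 - e) (1 - μ) (1 - ν) x :=
  of_compl (by rwa [sub_sub_cancel])

end IsPeirceEigen

/-- The four Peirce components are independent. -/
lemma IsPeirceEigen.independent {e x₁₁ x₁₂ x₂₁ x₂₂ : A} (h₁₁ : IsPeirceEigen e 1 1 x₁₁)
    (h₁₂ : IsPeirceEigen e 1 0 x₁₂) (h₂₁ : IsPeirceEigen e 0 1 x₂₁)
    (h₂₂ : IsPeirceEigen e 0 0 x₂₂) (h : x₁₁ + x₁₂ + x₂₁ + x₂₂ = 0) :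
    x₁₁ = 0 ∧ x₁₂ = 0 ∧ x₂₁ = 0 ∧ x₂₂ = 0 := by
  simp only [IsPeirceEigen, one_smul, zero_smul] at *
  have hl : x₁₁ + x₁₂ = 0 := by
    simpa [mul_add, h₁₁.1, h₁₂.1, h₂₁.1, h₂₂.1] using congrArg (e * ·) h
  have hr : x₁₁ + x₂₁ = 0 := by
    simpa [add_mul, h₁₁.2, h₁₂.2, h₂₁.2, h₂₂.2] using congrArg (· * e) h
  have h0 : x₁₁ = 0 := by
    simpa [add_mul, h₁₁.2, h₁₂.2] using congrArg (· * e) hl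
  subst h0
  simp_all

lemma IsPeirceEigen.sandwich_sum {e x₁₁ x₁₂ x₂₁ x₂₂ : A} (h₁₁ : IsPeirceEigen e 1 1 x₁₁)
    (h₁₂ : IsPeirceEigen e 1 0 x₁₂) (h₂₁ : IsPeirceEigen e 0 1 x₂₁)
    (h₂₂ : IsPeirceEigen e 0 0 x₂₂) :
    sandwich (1 - e) e (x₁₁ + x₁₂ + x₂₁ + x₂₂) = x₂₁ := by
  simp only [IsPeirceEigen, one_smul, zero_smul] at *
  simp [sandwich_apply, add_mul, mul_add, sub_mul, *]

lemma lastTwoFamily_last (m : ℕ) (x y : A) :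
    lastTwoFamily (m + 2) x y (Fin.last (m + 1)) = y := by
  simp [lastTwoFamily]

lemma lastTwoFamily_castSucc_last (m : ℕ) (x y : A) :
    lastTwoFamily (m + 2) x y (Fin.last m).castSucc = x := by
  simp [lastTwoFamily]

lemma lastTwoFamily_castSucc_castSucc (m : ℕ) (x y : A) (i : Fin m) :
    lastTwoFamily (m + 2) x y i.castSucc.castSucc = 1 := by
  have := i.isLt
  simp only [lastTwoFamily, Fin.val_castSucc]
  rw [if_neg (by omega), if_neg (by omega)]

variable [StarRing A]

/-- `e` is a symmetric idempotent of an alternative `*`-ring. -/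
structure IsAltProjection (e : A) : Prop where
  alt_left : ∀ a b : A, a * a * b = a * (a * b)
  alt_right : ∀ a b : A, b * a * a = b * (a * a)
  star_eq : star e = e
  idem : e * e = e

namespace IsAltProjection

variable {e : A}

lemma compl (he : IsAltProjection e) : IsAltProjection (1 - e) where
  alt_left := he.alt_left
  alt_right := he.alt_right
  star_eq := by simp [he.star_eq]
  idem := by simp [mul_sub, sub_mul, he.idem]

lemma alt_left_add (he : IsAltProjection e) (a b c : A) :
    a * b * c + b * a * c = a * (b * c) + b * (a * c) := by
  have h := he.alt_left (a + b) c
  simp only [add_mul, mul_add, he.alt_left] at h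
  rw [← sub_eq_zero] at h ⊢
  rw [← h]
  abel

lemma alt_right_add (he : IsAltProjection e) (a b c : A) :
    c * a * b + c * b * a = c * (a * b) + c * (b * a) := by
  have h := he.alt_right (a + b) c
  simp only [add_mul, mul_add, he.alt_right] at h
  rw [← sub_eq_zero] at h ⊢
  rw [← h]
  abel

lemma flexible (he : IsAltProjection e) (a b : A) : a * b * a = a * (b * a) := by
  have h := he.alt_left_add a b a
  rw [he.alt_right] at h
  exact add_right_cancel h

lemma left_idem (he : IsAltProjection e) (x : A) : e * (e * x) = e * x := by
  rw [← he.alt_left, he.idem]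

lemma right_idem (he : IsAltProjection e) (x : A) : x * e * e = x * e := by
  rw [he.alt_right, he.idem]

lemma eigen_mul (he : IsAltProjection e) {μ ν μ' ν' : ℤ} {x y : A}
    (hx : IsPeirceEigen e μ ν x) (hy : IsPeirceEigen e μ' ν' y) :
    IsPeirceEigen e (μ + ν - μ') (μ' + ν' - ν) (x * y) := by
  have h₁ := he.alt_left_add e x y
  have h₂ := he.alt_right_add e y x
  rw [hx.1, hx.2, hy.1] at h₁
  rw [hx.2, hy.1, hy.2] at h₂
  simp only [smul_mul_assoc, mul_smul_comm] at h₁ h₂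
  constructor
  · rw [sub_smul, add_smul, h₁]; abel
  · rw [sub_smul, add_smul, ← h₂]; abel

lemma eigen_star (he : IsAltProjection e) {μ ν : ℤ} {x : A} (hx : IsPeirceEigen e μ ν x) :
    IsPeirceEigen e ν μ (star x) := by
  constructor
  · have := congrArg star hx.2
    rwa [star_mul, he.star_eq, star_zsmul] at this
  · have := congrArg star hx.1
    rwa [star_mul, he.star_eq, star_zsmul] at this

lemma eigen_eq_zero [IsAddTorsionFree A] (he : IsAltProjection e) {μ ν : ℤ} {x : A}
    (hx : IsPeirceEigen e μ ν x) (h : μ * μ - μ ≠ 0 ∨ ν * ν - ν ≠ 0) : x = 0 := by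
  rcases h with h | h
  · have h' := he.left_idem x
    simp only [hx.1, mul_smul_comm, smul_smul] at h'
    rw [← sub_eq_zero, ← sub_smul] at h'
    exact (smul_eq_zero.mp h').resolve_left h
  · have h' := he.right_idem x
    simp only [hx.2, smul_mul_assoc, smul_smul] at h'
    rw [← sub_eq_zero, ← sub_smul] at h'
    exact (smul_eq_zero.mp h').resolve_left h

/-- Every element is the sum of its Peirce components. -/
lemma exists_eigen (he : IsAltProjection e) (x : A) : ∃ x₁₁ x₁₂ x₂₁ x₂₂ : A,
    IsPeirceEigen e 1 1 x₁₁ ∧ IsPeirceEigen e 1 0 x₁₂ ∧ IsPeirceEigen e 0 1 x₂₁ ∧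
    IsPeirceEigen e 0 0 x₂₂ ∧ x = x₁₁ + x₁₂ + x₂₁ + x₂₂ := by
  refine ⟨e * x * e, e * x - e * x * e, x * e - e * x * e, x - e * x - x * e + e * x * e,
    ?_, ?_, ?_, ?_, by abel⟩ <;>
  simp [IsPeirceEigen, mul_sub, sub_mul, mul_add, add_mul, he.flexible, he.left_idem,
    he.right_idem]

lemma sandwich_mul_right (he : IsAltProjection e) (a x : A) :
    sandwich a e (x * e) = sandwich a e x := by
  rw [sandwich_apply, sandwich_apply, he.right_idem]

lemma sandwich_mul_left (he : IsAltProjection e) (x : A) :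
    sandwich (1 - e) e (e * x) = 0 := by
  rw [sandwich_apply, he.flexible, sub_mul, one_mul, he.left_idem, sub_self]

lemma star_sandwich (he : IsAltProjection e) (x : A) :
    star (sandwich (1 - e) e x) = sandwich e (1 - e) (star x) := by
  simp [sandwich_apply, he.star_eq, mul_sub, he.flexible, sub_mul]

lemma star_sandwich_right (he : IsAltProjection e) (x : A) :
    star (sandwich e (1 - e) x) = sandwich (1 - e) e (star x) := by
  rw [← star_star (sandwich (1 - e) e (star x)), he.star_sandwich, star_star]

/-- An element without off-diagonal components is diagonal. -/
lemma exists_diagonal (he : IsAltProjection e) {x : A} (h : sandwich (1 - e) e x = 0)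
    (h' : sandwich (1 - e) e (star x) = 0) :
    ∃ x₁ x₂ : A, IsPeirceEigen e 1 1 x₁ ∧ IsPeirceEigen e 0 0 x₂ ∧ x = x₁ + x₂ := by
  obtain ⟨a, b, c, d, ha, hb, hc, hd, rfl⟩ := he.exists_eigen x
  rw [IsPeirceEigen.sandwich_sum ha hb hc hd] at h
  have : star (a + b + c + d) = star a + star c + star b + star d := by
    simp only [star_add]; abel
  rw [this, IsPeirceEigen.sandwich_sum (he.eigen_star ha) (he.eigen_star hc) (he.eigen_star hb)
    (he.eigen_star hd), star_eq_zero] at h'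
  exact ⟨a, d, ha, hd, by simp [h, h']⟩

end IsAltProjection

/-- The identity obtained from the `*`-Jordan `n`-derivation identity by collecting the
contributions of the leading units, with `N = 2 ^ (n - 2)`. -/
structure IsTwistedDerivation (Φ : A → A) (N α β : ℕ) : Prop where
  lt : α < N + β
  ne_zero : N ≠ 0
  map_starJordan : ∀ x y, Φ (N • starJordan x y) =
    starJordan (N • Φ x + starJordan (α • Φ 1 + β • star (Φ 1)) x) y + N • starJordan x (Φ y)

namespace IsTwistedDerivation

variable {e : A} {Φ : A → A} {N α β : ℕ}

lemma map_zero (h : IsTwistedDerivation Φ N α β) : Φ 0 = 0 := by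
  simpa [starJordan] using h.map_starJordan 0 0

lemma sandwich_relations (he : IsAltProjection e) (h : IsTwistedDerivation Φ N α β) :
    N • sandwich (1 - e) e (Φ 1) +
      sandwich (1 - e) e (star (α • Φ 1 + β • star (Φ 1))) = 0 := by
  have h₁ := h.map_starJordan 1 e
  have h₂ := h.map_starJordan e e
  have h₃ : starJordan 1 e = starJordan e e := by simp [starJordan, he.star_eq, he.idem]
  rw [h₃, h₂] at h₁
  replace h₁ := congrArg (sandwich (1 - e) e) h₁
  simp only [starJordan, star_one, mul_one, one_mul, star_add, star_mul, he.star_eq, mul_add,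
    add_mul, map_add, map_nsmul, he.sandwich_mul_right, he.sandwich_mul_left, star_nsmul,
    smul_mul_assoc, mul_smul_comm, smul_add, smul_zero, add_zero, star_star] at h₁ ⊢
  rw [← sub_eq_zero] at h₁
  rw [← neg_eq_zero, ← h₁]
  abel

lemma sandwich_map_one [IsAddTorsionFree A] (he : IsAltProjection e)
    (h : IsTwistedDerivation Φ N α β) :
    sandwich (1 - e) e (Φ 1) = 0 ∧ sandwich (1 - e) e (star (Φ 1)) = 0 := by
  have h₁ := h.sandwich_relations he
  have h₂ := congrArg star (h.sandwich_relations he.compl)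
  simp only [star_add, star_nsmul, he.star_sandwich_right, sub_sub_cancel, star_star, map_add,
    map_nsmul, star_zero] at h₁ h₂
  set x := sandwich (1 - e) e (Φ 1)
  set y := sandwich (1 - e) e (star (Φ 1))
  have hN : ((N + β : ℤ) * (N + β) - α * α) ≠ 0 := by
    have := h.lt
    have : (α : ℤ) < N + β := by exact_mod_cast this
    nlinarith
  simp only [← natCast_zsmul] at h₁ h₂
  have h₁' : (N + β : ℤ) • x + (α : ℤ) • y = 0 := by rw [← h₁]; module
  have h₂' : (N + β : ℤ) • y + (α : ℤ) • x = 0 := by rw [← h₂]; module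
  constructor
  · refine (smul_eq_zero.mp ?_).resolve_left hN
    linear_combination (norm := module) (N + β : ℤ) • h₁' - (α : ℤ) • h₂'
  · refine (smul_eq_zero.mp ?_).resolve_left hN
    linear_combination (norm := module) (N + β : ℤ) • h₂' - (α : ℤ) • h₁'

lemma sandwich_map_projection [IsAddTorsionFree A] (he : IsAltProjection e)
    (h : IsTwistedDerivation Φ N α β) :
    sandwich (1 - e) e (star (Φ e)) = sandwich (1 - e) e (Φ e) := by
  obtain ⟨hd, hd'⟩ := h.sandwich_map_one he
  have h₁ := h.map_starJordan 1 e
  have h₂ := h.map_starJordan e e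
  have h₃ : starJordan 1 e = starJordan e e := by simp [starJordan, he.star_eq, he.idem]
  rw [h₃, h₂] at h₁
  replace h₁ := congrArg (fun z => sandwich (1 - e) e (star z)) h₁
  simp only [starJordan, star_one, mul_one, one_mul, star_add, star_mul, he.star_eq, mul_add,
    add_mul, map_add, map_nsmul, he.sandwich_mul_right, he.sandwich_mul_left, star_nsmul,
    smul_mul_assoc, mul_smul_comm, smul_add, smul_zero, add_zero, zero_add, star_star,
    hd, hd'] at h₁
  rw [add_comm, add_left_cancel_iff] at h₁
  exact (nsmul_right_injective h.ne_zero h₁).symm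

lemma map_projection_mul [IsAddTorsionFree A] (he : IsAltProjection e)
    (h : IsTwistedDerivation Φ N α β) :
    ∃ p r w q₂₂ t₁ t₂ : A, IsPeirceEigen e 1 1 p ∧ IsPeirceEigen e 0 0 r ∧
      IsPeirceEigen e 1 0 w ∧ IsPeirceEigen e 0 0 q₂₂ ∧ IsPeirceEigen e 1 1 t₁ ∧
      IsPeirceEigen e 0 0 t₂ ∧ Φ e = p + w + star w + r ∧ Φ (1 - e) = q₂₂ - w - star w ∧
      α • Φ 1 + β • star (Φ 1) = t₁ + t₂ := by
  obtain ⟨hd, hd'⟩ := h.sandwich_map_one he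
  obtain ⟨t₁, t₂, ht₁, ht₂, ht⟩ := he.exists_diagonal (x := α • Φ 1 + β • star (Φ 1))
    (by simp only [map_add, map_nsmul, hd, hd', smul_zero, add_zero])
    (by simp only [star_add, star_nsmul, star_star, map_add, map_nsmul, hd, hd', smul_zero,
      add_zero])
  have hp := h.sandwich_map_projection he
  obtain ⟨p, w, v, r, hp₁, hw, hv, hr, hpe⟩ := he.exists_eigen (Φ e)
  obtain ⟨a, b, c, d, ha, hb, hc, hd, hq⟩ := he.exists_eigen (Φ (1 - e))
  have hv' : star w = v := by
    have hs : star (p + w + v + r) = star p + star v + star w + star r := by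
      simp only [star_add]; abel
    rwa [hpe, hs, IsPeirceEigen.sandwich_sum (he.eigen_star hp₁) (he.eigen_star hv)
      (he.eigen_star hw) (he.eigen_star hr), IsPeirceEigen.sandwich_sum hp₁ hw hv hr] at hp
  subst hv'
  have key := h.map_starJordan e (1 - e)
  have h0 : starJordan e (1 - e) = 0 := by
    simp [starJordan, he.star_eq, mul_sub, sub_mul, he.idem]
  rw [h0, smul_zero, h.map_zero, ht, hpe, hq] at key
  have hps := he.eigen_star hp₁
  have hrs := he.eigen_star hr
  have hts := he.eigen_star ht₁
  have hts₂ := he.eigen_star ht₂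
  have h1 : IsPeirceEigen e 1 1 (N • (a + a)) := (ha.add ha).nsmul N
  have h2 : IsPeirceEigen e 1 0 (N • (w + b)) := (hw.add hb).nsmul N
  have h3 : IsPeirceEigen e 0 1 (N • (star w + c)) := (hv.add hc).nsmul N
  have h4 : IsPeirceEigen e 0 0 (N • (r + star r)) := (hr.add hrs).nsmul N
  have hz := IsPeirceEigen.independent h1 h2 h3 h4 (by
    refine Eq.trans ?_ key.symm
    simp only [IsPeirceEigen, one_smul, zero_smul] at *
    simp only [starJordan, mul_add, add_mul, mul_sub, sub_mul, star_add,
      smul_mul_assoc, mul_smul_comm, star_nsmul, star_star, he.star_eq, one_mul, mul_one, sub_self,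
      hp₁, hw, hv, hr, ha, hb, hc, hd, ht₁, ht₂, hps, hrs, hts, hts₂,
      add_zero, zero_add, smul_zero, smul_add]
    abel)
  refine ⟨p, r, w, d, t₁, t₂, hp₁, hr, hw, hd, ht₁, ht₂, hpe, ?_, ht⟩
  obtain ⟨z1, z2, z3, -⟩ := hz
  rw [hq]
  have i1 : a = 0 := by
    have := (smul_eq_zero.mp z1).resolve_left h.ne_zero
    rw [← two_nsmul] at this
    exact (smul_eq_zero.mp this).resolve_left two_ne_zero
  have i2 := (smul_eq_zero.mp z2).resolve_left h.ne_zero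
  have i3 := (smul_eq_zero.mp z3).resolve_left h.ne_zero
  rw [i1, zero_add, ← neg_eq_of_add_eq_zero_right i2, ← neg_eq_of_add_eq_zero_right i3]
  abel

/-- The images of `e` and `1 - e` have opposite self-adjoint off-diagonal parts, and no component
in the opposite corner. -/
lemma map_projection [IsAddTorsionFree A] (he : IsAltProjection e)
    (h : IsTwistedDerivation Φ N α β) :
    ∃ p w q t₁ t₂ : A, IsPeirceEigen e 1 1 p ∧ IsPeirceEigen e 1 0 w ∧
      IsPeirceEigen e 0 0 q ∧ IsPeirceEigen e 1 1 t₁ ∧ IsPeirceEigen e 0 0 t₂ ∧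
      Φ e = p + w + star w ∧ Φ (1 - e) = q - w - star w ∧
      α • Φ 1 + β • star (Φ 1) = t₁ + t₂ := by
  obtain ⟨p, r, w, q, t₁, t₂, hp, hr, hw, hq, ht₁, ht₂, hpe, hqe, ht⟩ :=
    h.map_projection_mul he
  obtain ⟨-, -, v, s, -, -, -, -, hv, hs, -, -, -, hse, -⟩ := h.map_projection_mul he.compl
  rw [sub_sub_cancel, hpe] at hse
  have hr0 : r = 0 := by
    have h1 : IsPeirceEigen e 1 1 (p + -s) := hp.add hs.of_compl.neg
    have h2 : IsPeirceEigen e 1 0 (w + star v) := hw.add (he.eigen_star hv.of_compl)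
    have h3 : IsPeirceEigen e 0 1 (star w + v) := (he.eigen_star hw).add hv.of_compl
    refine (IsPeirceEigen.independent h1 h2 h3 hr ?_).2.2.2
    rw [← sub_eq_zero] at hse
    rw [← hse]
    abel
  exact ⟨p, w, q, t₁, t₂, hp, hw, hq, ht₁, ht₂, by rw [hpe, hr0, add_zero], hqe, ht⟩

lemma eigen_sub_innerDer_zero_zero [IsAddTorsionFree A] (he : IsAltProjection e)
    (h : IsTwistedDerivation Φ N α β) {y : A} (hy : IsPeirceEigen e 0 0 y) :
    IsPeirceEigen e 0 0
      (Φ y - innerDer (e * (Φ e * (1 - e)) + (1 - e) * (Φ e * e)) e y) := by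
  obtain ⟨p, w, q, t₁, t₂, hp, hw, hq, ht₁, ht₂, hpe, hqe, ht⟩ := h.map_projection he
  obtain ⟨a, b, c, d, ha, hb, hc, hd, hF⟩ := he.exists_eigen (Φ y)
  have hws := he.eigen_star hw
  have hps := he.eigen_star hp
  have hts₁ := he.eigen_star ht₁
  have hts₂ := he.eigen_star ht₂
  have hwy : IsPeirceEigen e 1 0 (w * y) := he.eigen_mul hw hy
  have hyw : IsPeirceEigen e 0 1 (y * star w) := he.eigen_mul hy hws
  have z₁ := he.eigen_eq_zero (he.eigen_mul hp hy) (by norm_num)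
  have z₂ := he.eigen_eq_zero (he.eigen_mul hy hps) (by norm_num)
  have z₃ := he.eigen_eq_zero (he.eigen_mul hy hw) (by norm_num)
  have z₄ := he.eigen_eq_zero (he.eigen_mul hws hy) (by norm_num)
  have z₅ := he.eigen_eq_zero (he.eigen_mul ht₁ hy) (by norm_num)
  have z₆ := he.eigen_eq_zero (he.eigen_mul hy ht₁) (by norm_num)
  have z₇ := he.eigen_eq_zero (he.eigen_mul hts₁ hy) (by norm_num)
  have z₈ := he.eigen_eq_zero (he.eigen_mul hy hts₁) (by norm_num)
  have h1 : IsPeirceEigen e 1 1 (N • (a + a)) := (ha.add ha).nsmul N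
  have h2 : IsPeirceEigen e 1 0 (N • (w * y + b)) := (hwy.add hb).nsmul N
  have h3 : IsPeirceEigen e 0 1 (N • (y * star w + c)) := (hyw.add hc).nsmul N
  have h4 : IsPeirceEigen e 0 0 0 := by simp [IsPeirceEigen]
  have key := h.map_starJordan e y
  have hd' := hd
  simp only [IsPeirceEigen, one_smul, zero_smul] at hp hw hws hps ht₁ ht₂
  simp only [IsPeirceEigen, one_smul, zero_smul] at hts₁ hts₂ hwy hyw ha hb hc hd hy
  have h0 : starJordan e y = 0 := by simp [starJordan, he.star_eq, hy]
  rw [h0, smul_zero, h.map_zero, ht, hpe, hF] at key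
  obtain ⟨e1, e2, e3, -⟩ := IsPeirceEigen.independent h1 h2 h3 h4 (by
    refine Eq.trans ?_ key.symm
    simp only [starJordan, mul_add, add_mul, star_add,
      smul_mul_assoc, mul_smul_comm, star_nsmul, star_star, he.star_eq, ht₁,
      ht₂, hts₁, hts₂, ha, hb, hc, hd, z₁, z₂, z₃, z₄, z₅, z₆, z₇, z₈,
      add_zero, zero_add, smul_zero, smul_add]
    abel)
  have i1 := (smul_eq_zero.mp e1).resolve_left h.ne_zero
  rw [← two_nsmul] at i1
  replace i1 := (smul_eq_zero.mp i1).resolve_left two_ne_zero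
  have i2 := (smul_eq_zero.mp e2).resolve_left h.ne_zero
  have i3 := (smul_eq_zero.mp e3).resolve_left h.ne_zero
  convert hd' using 1
  have hW : e * (Φ e * (1 - e)) + (1 - e) * (Φ e * e) = w + star w := by
    simp [hpe, mul_sub, sub_mul, mul_add, add_mul, hp, hw, hws]
  rw [hW, hF, i1, ← neg_eq_of_add_eq_zero_right i2, ← neg_eq_of_add_eq_zero_right i3]
  simp only [innerDer, mul_add, add_mul, hy, hwy, hyw, z₃, z₄, mul_zero, zero_mul,
    add_zero, zero_add]
  abel

lemma eigen_sub_innerDer_one_zero [IsAddTorsionFree A] (he : IsAltProjection e)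
    (h : IsTwistedDerivation Φ N α β) {y : A} (hy : IsPeirceEigen e 1 0 y) :
    IsPeirceEigen e 1 0
      (Φ y - innerDer (e * (Φ e * (1 - e)) + (1 - e) * (Φ e * e)) e y) := by
  obtain ⟨p, w, q, t₁, t₂, hp, hw, hq, ht₁, ht₂, hpe, hqe, ht⟩ := h.map_projection he
  obtain ⟨a, b, c, d, ha, hb, hc, hd, hF⟩ := he.exists_eigen (Φ y)
  have hws := he.eigen_star hw
  have hps := he.eigen_star hp
  have hqs := he.eigen_star hq
  have hts₁ := he.eigen_star ht₁
  have hts₂ := he.eigen_star ht₂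
  have hys := he.eigen_star hy
  have has := he.eigen_star ha
  have hbs := he.eigen_star hb
  have hcs := he.eigen_star hc
  have hds := he.eigen_star hd
  have k₁ : IsPeirceEigen e 0 1 (w * y) := he.eigen_mul hw hy
  have k₂ : IsPeirceEigen e 0 0 (star w * y) := he.eigen_mul hws hy
  have k₃ : IsPeirceEigen e 0 1 (y * w) := he.eigen_mul hy hw
  have k₄ : IsPeirceEigen e 1 1 (y * star w) := he.eigen_mul hy hws
  have k₅ : IsPeirceEigen e 1 0 (p * y) := he.eigen_mul hp hy
  have k₆ : IsPeirceEigen e 1 0 (y * star q) := he.eigen_mul hy hqs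
  have k₇ : IsPeirceEigen e 1 0 (t₁ * y) := he.eigen_mul ht₁ hy
  have k₈ : IsPeirceEigen e 1 0 (star t₁ * y) := he.eigen_mul hts₁ hy
  have k₉ : IsPeirceEigen e 1 0 (y * t₂) := he.eigen_mul hy ht₂
  have k₁₀ : IsPeirceEigen e 1 0 (y * star t₂) := he.eigen_mul hy hts₂
  have k₁₁ : IsPeirceEigen e 1 1 (w * star y) := he.eigen_mul hw hys
  have k₁₂ : IsPeirceEigen e 1 0 (star w * star y) := he.eigen_mul hws hys
  have k₁₃ : IsPeirceEigen e 0 1 (t₂ * star y) := he.eigen_mul ht₂ hys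
  have k₁₄ : IsPeirceEigen e 0 1 (star y * star t₁) := he.eigen_mul hys hts₁
  have z₁ := he.eigen_eq_zero (he.eigen_mul hy hps) (by norm_num)
  have z₂ := he.eigen_eq_zero (he.eigen_mul hq hy) (by norm_num)
  have z₃ := he.eigen_eq_zero (he.eigen_mul hy hts₁) (by norm_num)
  have z₄ := he.eigen_eq_zero (he.eigen_mul hy ht₁) (by norm_num)
  have z₅ := he.eigen_eq_zero (he.eigen_mul ht₂ hy) (by norm_num)
  have z₆ := he.eigen_eq_zero (he.eigen_mul hts₂ hy) (by norm_num)
  have z₇ := he.eigen_eq_zero (he.eigen_mul hp hys) (by norm_num)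
  have z₈ := he.eigen_eq_zero (he.eigen_mul hy hp) (by norm_num)
  have h1 : IsPeirceEigen e 1 1 ((2 * N) • (a + y * star w)) := (ha.add k₄).nsmul _
  have h2 : IsPeirceEigen e 1 0 (N • (p * y) + t₁ * y + star t₁ * y +
      -(N • (y * star q) + y * t₂ + y * star t₂)) :=
    (((k₅.nsmul N).add k₇).add k₈).add (((k₆.nsmul N).add k₉).add k₁₀).neg
  have h3 : IsPeirceEigen e 0 1 ((2 * N) • (w * y + y * w)) := (k₁.add k₃).nsmul _
  have h4 : IsPeirceEigen e 0 0 ((2 * N) • (star w * y + -d)) := (k₂.add hd.neg).nsmul _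
  have g1 : IsPeirceEigen e 1 1 (N • (a + star a + y * star w + w * star y)) :=
    (((ha.add has).add k₄).add k₁₁).nsmul N
  have g2 : IsPeirceEigen e 1 0 (N • (star c + star w * star y)) := (hcs.add k₁₂).nsmul N
  have g3 : IsPeirceEigen e 0 1 (N • (c + y * w)) := (hc.add k₃).nsmul N
  have g4 : IsPeirceEigen e 0 0 0 := by simp [IsPeirceEigen]
  have key₁ := h.map_starJordan e y
  have key₂ := h.map_starJordan (1 - e) y
  have key₃ := h.map_starJordan y e
  have hb' := hb
  simp only [IsPeirceEigen, one_smul, zero_smul] at hp hw hq hws hps hqs ht₁ ht₂ hts₁ hts₂ hys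
  simp only [IsPeirceEigen, one_smul, zero_smul] at has hbs hcs hds ha hb hc hd hy
  simp only [IsPeirceEigen, one_smul, zero_smul] at k₁ k₂ k₃ k₄ k₅ k₆ k₇ k₈ k₉ k₁₀ k₁₁ k₁₂ k₁₃ k₁₄
  have s₁ : starJordan e y = y := by simp [starJordan, he.star_eq, hy]
  have s₂ : starJordan (1 - e) y = y := by simp [starJordan, he.star_eq, mul_sub, sub_mul, hy]
  have s₃ : starJordan y e = 0 := by simp [starJordan, hy, hys]
  rw [s₃, smul_zero, h.map_zero, ht, hpe, hF] at key₃
  rw [s₁, ht, hpe, hF] at key₁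
  rw [s₂, key₁, ht, hqe, hF, ← sub_eq_zero] at key₂
  obtain ⟨e1, -, -, e4⟩ := IsPeirceEigen.independent h1 h2 h3 h4 (by
    refine Eq.trans ?_ key₂
    simp only [starJordan, mul_add, add_mul, mul_sub, sub_mul, star_add, star_sub,
      star_one, one_mul, mul_one,
      smul_mul_assoc, mul_smul_comm, star_nsmul, star_star, he.star_eq,
      ht₁, ht₂, hts₁, hts₂, ha, hb, hc, hd, z₁, z₂, z₃, z₄, z₅, z₆,
      add_zero, zero_add, sub_zero, sub_self, smul_zero, smul_add, smul_sub, smul_neg, mul_smul,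
      two_nsmul]
    abel)
  obtain ⟨-, -, e3, -⟩ := IsPeirceEigen.independent g1 g2 g3 g4 (by
    refine Eq.trans ?_ key₃.symm
    simp only [starJordan, mul_add, add_mul, star_add, star_mul,
      smul_mul_assoc, mul_smul_comm, star_nsmul, star_star,
      has, hbs, hcs, hds, ha, hb, hc, hd, k₇, k₁₀, k₁₃, k₁₄, z₃, z₅, z₇, z₈,
      add_zero, zero_add, smul_zero, smul_add]
    abel)
  have hN : 2 * N ≠ 0 := mul_ne_zero two_ne_zero h.ne_zero
  have i1 := (smul_eq_zero.mp e1).resolve_left hN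
  have i3 := (smul_eq_zero.mp e3).resolve_left h.ne_zero
  have i4 := (smul_eq_zero.mp e4).resolve_left hN
  convert hb' using 1
  have hW : e * (Φ e * (1 - e)) + (1 - e) * (Φ e * e) = w + star w := by
    simp [hpe, mul_sub, sub_mul, mul_add, add_mul, hp, hw, hws]
  rw [hW, hF, ← neg_eq_of_add_eq_zero_left i1, ← neg_eq_of_add_eq_zero_left i3,
    ← eq_of_add_neg_eq_zero i4]
  simp only [innerDer, mul_add, add_mul, hy, k₁, k₂, k₃, k₄, mul_zero, zero_mul,
    add_zero]
  abel

lemma innerDer_compl (he : IsAltProjection e) [IsAddTorsionFree A]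
    (h : IsTwistedDerivation Φ N α β) (y : A) :
    innerDer ((1 - e) * (Φ (1 - e) * (1 - (1 - e))) + (1 - (1 - e)) * (Φ (1 - e) * (1 - e)))
      (1 - e) y = innerDer (e * (Φ e * (1 - e)) + (1 - e) * (Φ e * e)) e y := by
  obtain ⟨p, w, q, -, -, hp, hw, hq, -, -, hpe, hqe, -⟩ := h.map_projection he
  have hws := he.eigen_star hw
  simp only [IsPeirceEigen, one_smul, zero_smul] at hp hw hws hq
  have hW : e * (Φ e * (1 - e)) + (1 - e) * (Φ e * e) = w + star w := by
    simp [hpe, mul_sub, sub_mul, mul_add, add_mul, hp, hw, hws]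
  have hW' : (1 - e) * (Φ (1 - e) * e) + e * (Φ (1 - e) * (1 - e)) = -(w + star w) := by
    simp [hqe, mul_sub, sub_mul, hq, hw, hws]
  rw [sub_sub_cancel, hW, hW']
  simp only [innerDer, mul_sub, sub_mul, neg_mul, mul_neg, mul_one, one_mul]
  abel

end IsTwistedDerivation

lemma leftStarJordan_ofFn_succ {m : ℕ} (f : Fin (m + 2) → A) :
    leftStarJordan (List.ofFn f) =
      starJordan (leftStarJordan (List.ofFn fun i : Fin (m + 1) => f i.castSucc))
        (f (Fin.last (m + 1))) := by
  rw [List.ofFn_succ' f, List.concat_eq_append, List.ofFn_succ]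
  simp [leftStarJordan]

lemma sum_leftStarJordan_update_succ {m : ℕ} (f g : Fin (m + 2) → A) :
    ∑ k, leftStarJordan (List.ofFn (Function.update f k (g k))) =
      starJordan (∑ k : Fin (m + 1), leftStarJordan (List.ofFn
        (Function.update (fun i : Fin (m + 1) => f i.castSucc) k (g k.castSucc))))
          (f (Fin.last (m + 1))) +
      starJordan (leftStarJordan (List.ofFn fun i : Fin (m + 1) => f i.castSucc))
        (g (Fin.last (m + 1))) := by
  rw [Fin.sum_univ_castSucc]
  congr 1
  · simp only [starJordan, star_sum, Finset.sum_mul, Finset.mul_sum, ← Finset.sum_add_distrib]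
    refine Finset.sum_congr rfl fun k _ => ?_
    rw [leftStarJordan_ofFn_succ, Function.update_of_ne (Fin.castSucc_lt_last k).ne']
    have : (fun i : Fin (m + 1) => Function.update f k.castSucc (g k.castSucc) i.castSucc) =
        Function.update (fun i : Fin (m + 1) => f i.castSucc) k (g k.castSucc) :=
      Function.update_comp_eq_of_injective f (Fin.castSucc_injective _) k _
    rw [this, starJordan]
  · rw [leftStarJordan_ofFn_succ, Function.update_self]
    congr 4
    ext i
    rw [Function.update_of_ne (Fin.castSucc_lt_last i).ne]

lemma leftStarJordan_ofFn_one (m : ℕ) :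
    leftStarJordan (List.ofFn fun _ : Fin (m + 1) => (1 : A)) = 2 ^ m • (1 : A) := by
  induction m with
  | zero => simp [leftStarJordan]
  | succ m ih =>
    rw [leftStarJordan_ofFn_succ, ih, starJordan, star_nsmul, star_one, mul_one, one_mul,
      ← two_nsmul, smul_smul, pow_succ']

lemma exists_sum_leftStarJordan_update_one (m : ℕ) (d : A) :
    ∃ β : ℕ, ∑ k, leftStarJordan (List.ofFn
      (Function.update (fun _ : Fin (m + 1) => (1 : A)) k d)) =
        (β + 2 ^ m) • d + β • star d := by
  induction m with
  | zero => exact ⟨0, by simp [leftStarJordan]⟩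
  | succ m ih =>
    obtain ⟨β, hβ⟩ := ih
    refine ⟨β + (β + 2 ^ m), ?_⟩
    rw [sum_leftStarJordan_update_succ _ fun _ => d, hβ, leftStarJordan_ofFn_one]
    simp only [starJordan, star_add, star_nsmul, star_star, mul_one, one_mul, smul_mul_assoc,
      mul_smul_comm, star_one]
    module

lemma exists_isTwistedDerivation {n : ℕ} (hn : 2 ≤ n) {Φ : A → A}
    (hΦ : ∀ x y : A,
      Φ (leftStarJordan (List.ofFn (lastTwoFamily n x y))) =
        ∑ k : Fin n, leftStarJordan (List.ofFn
          (Function.update (lastTwoFamily n x y) k (Φ (lastTwoFamily n x y k))))) :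
    ∃ N α β : ℕ, IsTwistedDerivation Φ N α β := by
  obtain ⟨m, rfl⟩ := Nat.exists_eq_add_of_le' hn
  cases m with
  | zero =>
    refine ⟨1, 0, 0, by simp, by simp, fun x y => ?_⟩
    have h := hΦ x y
    rw [sum_leftStarJordan_update_succ _ fun k => Φ (lastTwoFamily _ x y k)] at h
    simpa [leftStarJordan, lastTwoFamily, starJordan] using h
  | succ m =>
    obtain ⟨β, hβ⟩ := exists_sum_leftStarJordan_update_one m (Φ 1)
    refine ⟨2 ^ (m + 1), β + 2 ^ m, β, ?_, by positivity, fun x y => ?_⟩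
    · have := Nat.pow_lt_pow_right (a := 2) (by norm_num) (Nat.lt_succ_self m)
      omega
    have h := hΦ x y
    rw [sum_leftStarJordan_update_succ _ fun k => Φ (lastTwoFamily _ x y k),
      sum_leftStarJordan_update_succ _ fun k => Φ (lastTwoFamily _ x y k.castSucc),
      leftStarJordan_ofFn_succ, leftStarJordan_ofFn_succ] at h
    simp only [lastTwoFamily_last, lastTwoFamily_castSucc_last, lastTwoFamily_castSucc_castSucc,
      hβ, leftStarJordan_ofFn_one] at h
    have hu (z : A) : starJordan (2 ^ m • (1 : A)) z = 2 ^ (m + 1) • z := by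
      rw [starJordan, star_nsmul, star_one, smul_mul_assoc, mul_smul_comm, one_mul, mul_one,
        ← two_nsmul, smul_smul, pow_succ']
    have hs (a b : A) : starJordan (2 ^ (m + 1) • a) b = 2 ^ (m + 1) • starJordan a b := by
      simp only [starJordan, star_nsmul, smul_mul_assoc, mul_smul_comm, smul_add]
    rw [hu, hu, hs, hs, add_comm (starJordan _ x)] at h
    exact h

end AlternativePeirce

theorem stmt_16 {A : Type*} [NonAssocRing A] [Module ℂ A]
    [SMulCommClass ℂ A A] [IsScalarTower ℂ A A] [StarRing A]
    (halt₁ : ∀ a b : A, a * a * b = a * (a * b))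
    (halt₂ : ∀ a b : A, b * a * a = b * (a * a))
    (e : A) (heStar : star e = e) (heIdem : e * e = e) (he0 : e ≠ 0) (he1 : e ≠ 1)
    (hsp : ∀ x : A, (∀ r : A, x * r * e = 0) → x = 0)
    (hcl : ∀ x : A, (∀ r : A, x * r * (1 - e) = 0) → x = 0)
    (n : ℕ) (hn : 2 ≤ n) (Φ : A → A)
    (hΦ : ∀ x y : A,
      Φ (leftStarJordan (List.ofFn (lastTwoFamily n x y))) =
        ∑ k : Fin n, leftStarJordan (List.ofFn
          (Function.update (lastTwoFamily n x y) k (Φ (lastTwoFamily n x y k))))) :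
    ∀ φ : A → A,
      (∀ a : A, φ a = Φ a -
        innerDer (e * (Φ e * (1 - e)) + (1 - e) * (Φ e * e)) e a) →
      ∀ i j : Fin 2, ∀ a : A, inPeirce e i j a → inPeirce e i j (φ a) := by
  intro φ hφ i j a ha
  have : IsAddTorsionFree A := IsAddTorsionFree.of_isTorsionFree ℂ A
  have he : IsAltProjection e := ⟨halt₁, halt₂, heStar, heIdem⟩
  obtain ⟨N, α, β, h⟩ := exists_isTwistedDerivation hn hΦ
  rw [hφ]
  rw [inPeirce_iff] at ha ⊢
  fin_cases i <;> fin_cases j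
  · rw [← h.innerDer_compl he]
    exact (h.eigen_sub_innerDer_zero_zero he.compl ha.compl).of_compl
  · exact h.eigen_sub_innerDer_one_zero he ha
  · rw [← h.innerDer_compl he]
    exact (h.eigen_sub_innerDer_one_zero he.compl ha.compl).of_compl
  · exact h.eigen_sub_innerDer_zero_zero he ha
end
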